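/- arXiv:math/0507108 — 2 statements merged into one kernel-verified Lean document; each statement's English description precedes it below -/
import Mathlib

section
/- For every real number x with 0 ≤ x ≤ 1, one has (1 + √x) · ∑_{m=0}^∞ (−1/(2m−1)) · (C(2m,m)/4^m)² · (2·x^{1/4}/(1+√x))^{2m} = ∑_{n=0}^∞ (C(2n,n)/((2n−1)·4^n))² · x^n, where C(a,b) denotes the ordinary binomial coefficient. (Both series converge absolutely for 0 ≤ x ≤ 1; the m = 0 and n = 0 terms equal 1 since −1/(2·0−1) = 1.) -/
open Finset MeasureTheory

/-- The coefficients of the power series of `√(1 - z)`. -/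
noncomputable def sqrtCoeff (n : ℕ) : ℝ :=
  -((Nat.choose (2 * n) n : ℝ) / ((2 * (n : ℝ) - 1) * 4 ^ n))

lemma centralBinom_succ_eq_mul_catalan (n : ℕ) :
    (Nat.centralBinom (n + 1) : ℝ) = 2 * (2 * n + 1) * (catalan n : ℝ) := by
  have h1 : ((n : ℝ) + 1) * (Nat.centralBinom (n + 1) : ℝ)
      = 2 * (2 * n + 1) * (Nat.centralBinom n : ℝ) := by
    exact_mod_cast Nat.succ_mul_centralBinom_succ n
  have h2 : ((n : ℝ) + 1) * (catalan n : ℝ) = (Nat.centralBinom n : ℝ) := by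
    exact_mod_cast succ_mul_catalan_eq_centralBinom n
  have hn : (n : ℝ) + 1 ≠ 0 := by positivity
  apply mul_left_cancel₀ hn
  rw [h1, ← h2]
  ring

lemma sqrtCoeff_zero : sqrtCoeff 0 = 1 := by
  norm_num [sqrtCoeff]

lemma sqrtCoeff_succ (n : ℕ) : sqrtCoeff (n + 1) = -(2 * (catalan n : ℝ) / 4 ^ (n + 1)) := by
  have hn : 2 * (n : ℝ) + 1 ≠ 0 := by positivity
  rw [sqrtCoeff, ← Nat.centralBinom_eq_two_mul_choose, centralBinom_succ_eq_mul_catalan]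
  push_cast
  rw [show 2 * ((n : ℝ) + 1) - 1 = 2 * n + 1 by ring]
  field_simp

lemma sqrtCoeff_succ_nonpos (n : ℕ) : sqrtCoeff (n + 1) ≤ 0 := by
  rw [sqrtCoeff_succ, neg_nonpos]
  positivity

lemma sqrtCoeff_succ_eq_sub (n : ℕ) : sqrtCoeff (n + 1) =
    (Nat.centralBinom (n + 1) : ℝ) / 4 ^ (n + 1) - (Nat.centralBinom n : ℝ) / 4 ^ n := by
  have h : ((n : ℝ) + 1) * (catalan n : ℝ) = (Nat.centralBinom n : ℝ) := by
    exact_mod_cast succ_mul_catalan_eq_centralBinom n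
  rw [sqrtCoeff_succ, centralBinom_succ_eq_mul_catalan, ← h, pow_succ]
  field_simp
  ring

lemma summable_abs_sqrtCoeff : Summable fun n => |sqrtCoeff n| := by
  rw [← summable_nat_add_iff 1]
  refine summable_of_sum_range_le (c := 1) (fun n => abs_nonneg _) fun n => ?_
  have h : ∀ i, |sqrtCoeff (i + 1)| =
      (Nat.centralBinom i : ℝ) / 4 ^ i - (Nat.centralBinom (i + 1) : ℝ) / 4 ^ (i + 1) := by
    intro i
    rw [abs_of_nonpos (sqrtCoeff_succ_nonpos i), sqrtCoeff_succ_eq_sub]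
    ring
  simp_rw [h]
  rw [Finset.sum_range_sub' (fun i => (Nat.centralBinom i : ℝ) / 4 ^ i)]
  have : 0 ≤ (Nat.centralBinom n : ℝ) / 4 ^ n := by positivity
  simpa using this

lemma sum_antidiagonal_sqrtCoeff_add_two (n : ℕ) :
    ∑ p ∈ antidiagonal (n + 2), sqrtCoeff p.1 * sqrtCoeff p.2 = 0 := by
  rw [Finset.Nat.sum_antidiagonal_succ, Finset.Nat.sum_antidiagonal_succ']
  have h : ∑ p ∈ antidiagonal n, sqrtCoeff (p.1 + 1) * sqrtCoeff (p.2 + 1)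
      = 4 * (catalan (n + 1) : ℝ) / 4 ^ (n + 2) := by
    rw [catalan_succ', Nat.cast_sum, Finset.mul_sum, Finset.sum_div]
    refine Finset.sum_congr rfl fun p hp => ?_
    rw [sqrtCoeff_succ, sqrtCoeff_succ, ← mem_antidiagonal.mp hp]
    push_cast
    rw [show p.1 + p.2 + 2 = (p.1 + 1) + (p.2 + 1) by ring, pow_add]
    field_simp
    ring
  rw [h, sqrtCoeff_zero, sqrtCoeff_succ]
  ring

lemma summable_norm_sqrtCoeff_mul_pow {z : ℂ} (hz : ‖z‖ ≤ 1) :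
    Summable fun n => ‖(sqrtCoeff n : ℂ) * z ^ n‖ := by
  refine Summable.of_nonneg_of_le (fun _ => norm_nonneg _) (fun n => ?_) summable_abs_sqrtCoeff
  rw [norm_mul, norm_pow, Complex.norm_real, Real.norm_eq_abs]
  exact mul_le_of_le_one_right (abs_nonneg _) (pow_le_one₀ (norm_nonneg _) hz)

lemma tsum_sqrtCoeff_mul_pow_sq {z : ℂ} (hz : ‖z‖ ≤ 1) :
    (∑' n, (sqrtCoeff n : ℂ) * z ^ n) ^ 2 = 1 - z := by
  have hs := summable_norm_sqrtCoeff_mul_pow hz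
  rw [sq, tsum_mul_tsum_eq_tsum_sum_antidiagonal_of_summable_norm hs hs]
  have h : ∀ n, ∑ p ∈ antidiagonal n, ((sqrtCoeff p.1 : ℂ) * z ^ p.1) * (sqrtCoeff p.2 * z ^ p.2)
      = ((∑ p ∈ antidiagonal n, sqrtCoeff p.1 * sqrtCoeff p.2 : ℝ) : ℂ) * z ^ n := by
    intro n
    push_cast
    rw [Finset.sum_mul]
    refine Finset.sum_congr rfl fun p hp => ?_
    rw [← mem_antidiagonal.mp hp, pow_add]
    ring
  simp_rw [h]
  rw [tsum_eq_sum (s := range 2)]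
  · have h1 : sqrtCoeff 1 = -(1 / 2) := by norm_num [sqrtCoeff]
    simp only [sum_range_succ, range_zero, sum_empty, Finset.Nat.antidiagonal_succ,
      Finset.Nat.antidiagonal_zero]
    simp [sqrtCoeff_zero, h1]
    ring
  · intro n hn
    obtain ⟨k, rfl⟩ := Nat.exists_eq_add_of_le' (not_lt.mp (mem_range.not.mp hn))
    rw [sum_antidiagonal_sqrtCoeff_add_two]
    simp

lemma summable_abs_sqrtCoeff_mul_pow {t : ℝ} (h0 : 0 ≤ t) (h1 : t ≤ 1) :
    Summable fun n => |sqrtCoeff n * t ^ n| := by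
  refine Summable.of_nonneg_of_le (fun _ => abs_nonneg _) (fun n => ?_) summable_abs_sqrtCoeff
  rw [abs_mul, abs_of_nonneg (pow_nonneg h0 n)]
  exact mul_le_of_le_one_right (abs_nonneg _) (pow_le_one₀ h0 h1)

lemma tsum_sqrtCoeff_mul_pow_sq_real {t : ℝ} (h0 : 0 ≤ t) (h1 : t ≤ 1) :
    (∑' n, sqrtCoeff n * t ^ n) ^ 2 = 1 - t := by
  have := tsum_sqrtCoeff_mul_pow_sq (z := (t : ℂ)) (by simpa [abs_of_nonneg h0] using h1)
  exact_mod_cast this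

lemma tsum_sqrtCoeff_mul_pow {t : ℝ} (h0 : 0 ≤ t) (h1 : t ≤ 1) :
    ∑' n, sqrtCoeff n * t ^ n = √(1 - t) := by
  rw [← tsum_sqrtCoeff_mul_pow_sq_real h0 h1, Real.sqrt_sq]
  have hone : ∑' n, sqrtCoeff n * (1 : ℝ) ^ n = 0 := by
    have := tsum_sqrtCoeff_mul_pow_sq_real zero_le_one le_rfl
    simpa using this
  rw [← hone]
  refine Summable.tsum_le_tsum (fun n => ?_)
    (summable_abs_sqrtCoeff_mul_pow zero_le_one le_rfl).of_abs
    (summable_abs_sqrtCoeff_mul_pow h0 h1).of_abs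
  cases n with
  | zero => simp
  | succ n =>
    exact mul_le_mul_of_nonpos_left (by simpa using pow_le_one₀ h0 h1) (sqrtCoeff_succ_nonpos n)

lemma norm_tsum_sqrtCoeff_mul_pow_sq {z : ℂ} (hz : ‖z‖ ≤ 1) :
    ‖∑' n, (sqrtCoeff n : ℂ) * z ^ n‖ ^ 2 = ‖1 - z‖ := by
  rw [← norm_pow, tsum_sqrtCoeff_mul_pow_sq hz]

/-- The average of `sin ^ (2 * m)` over a period is the normalized central binomial coefficient. -/
lemma integral_sin_pow_two_mul (m : ℕ) :
    ∫ u in (0 : ℝ)..Real.pi, Real.sin u ^ (2 * m)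
      = Real.pi * ((Nat.choose (2 * m) m : ℝ) / 4 ^ m) := by
  rw [integral_sin_pow_even, ← Nat.centralBinom_eq_two_mul_choose]
  congr 1
  induction m with
  | zero => simp
  | succ m ih =>
    rw [prod_range_succ, ih]
    have h1 : ((m : ℝ) + 1) * (Nat.centralBinom (m + 1) : ℝ)
        = 2 * (2 * m + 1) * (Nat.centralBinom m : ℝ) := by
      exact_mod_cast Nat.succ_mul_centralBinom_succ m
    rw [pow_succ]
    field_simp
    linear_combination -2 * h1

/-- The complete elliptic integral of the second kind as a power series in the squared modulus. -/
lemma integral_sqrt_one_sub_mul_sin_sq {t : ℝ} (h0 : 0 ≤ t) (h1 : t ≤ 1) :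
    ∫ u in (0 : ℝ)..Real.pi, √(1 - t * Real.sin u ^ 2) =
      Real.pi * ∑' m, sqrtCoeff m * ((Nat.choose (2 * m) m : ℝ) / 4 ^ m) * t ^ m := by
  have key := intervalIntegral.hasSum_integral_of_dominated_convergence (μ := volume)
    (a := 0) (b := Real.pi)
    (F := fun (m : ℕ) (u : ℝ) => sqrtCoeff m * (t * Real.sin u ^ 2) ^ m)
    (f := fun u => √(1 - t * Real.sin u ^ 2)) (fun m _ => |sqrtCoeff m|)
    (fun m => Continuous.aestronglyMeasurable (by fun_prop))
    (fun m => Filter.Eventually.of_forall fun u _ => ?_)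
    (Filter.Eventually.of_forall fun u _ => summable_abs_sqrtCoeff)
    (by simp)
    (Filter.Eventually.of_forall fun u _ => ?_)
  · rw [← key.tsum_eq, ← tsum_mul_left]
    refine tsum_congr fun m => ?_
    rw [intervalIntegral.integral_const_mul]
    simp_rw [mul_pow, ← pow_mul]
    rw [intervalIntegral.integral_const_mul, integral_sin_pow_two_mul]
    ring
  all_goals
    have hu0 : 0 ≤ t * Real.sin u ^ 2 := by positivity
    have hu1 : t * Real.sin u ^ 2 ≤ 1 := mul_le_one₀ h1 (sq_nonneg _) (Real.sin_sq_le_one u)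
  · rw [Real.norm_eq_abs, abs_mul, abs_of_nonneg (pow_nonneg hu0 m)]
    exact mul_le_of_le_one_right (abs_nonneg _) (pow_le_one₀ hu0 hu1)
  · rw [← tsum_sqrtCoeff_mul_pow hu0 hu1]
    exact (summable_abs_sqrtCoeff_mul_pow hu0 hu1).of_abs.hasSum

lemma integral_exp_two_mul_int_mul_I (k : ℤ) :
    ∫ u in (0 : ℝ)..Real.pi, Complex.exp (2 * k * Complex.I * u)
      = if k = 0 then (Real.pi : ℂ) else 0 := by
  split_ifs with hk
  · simp [hk]
  · have hc : 2 * (k : ℂ) * Complex.I ≠ 0 := by simp [hk]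
    rw [integral_exp_mul_complex hc,
      show 2 * (k : ℂ) * Complex.I * (Real.pi : ℝ) = k * (2 * Real.pi * Complex.I) by ring,
      Complex.exp_int_mul_two_pi_mul_I]
    simp

/-- Parseval's identity for an absolutely convergent power series on the circle of radius `q`. -/
lemma integral_norm_tsum_sq {a : ℕ → ℝ} (ha : Summable fun n => |a n|) {q : ℝ} (h0 : 0 ≤ q)
    (h1 : q ≤ 1) :
    ∫ u in (0 : ℝ)..Real.pi,
        ‖∑' n, (a n : ℂ) * (-(q : ℂ) * Complex.exp (2 * Complex.I * u)) ^ n‖ ^ 2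
      = Real.pi * ∑' n, a n ^ 2 * (q ^ 2) ^ n := by
  set z : ℝ → ℂ := fun u => -q * Complex.exp (2 * Complex.I * u) with hz
  have hnorm : ∀ u, ‖z u‖ = q := by
    intro u
    rw [hz]
    simp only [norm_mul, norm_neg, Complex.norm_real, Real.norm_eq_abs, abs_of_nonneg h0]
    rw [show 2 * Complex.I * (u : ℂ) = ((2 * u : ℝ) : ℂ) * Complex.I by push_cast; ring,
      Complex.norm_exp_ofReal_mul_I, mul_one]
  have hle : ∀ n u, ‖(a n : ℂ) * z u ^ n‖ ≤ |a n| := by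
    intro n u
    rw [norm_mul, norm_pow, Complex.norm_real, Real.norm_eq_abs, hnorm]
    exact mul_le_of_le_one_right (abs_nonneg _) (pow_le_one₀ h0 h1)
  have hs : ∀ u, Summable fun n => ‖(a n : ℂ) * z u ^ n‖ := fun u =>
    Summable.of_nonneg_of_le (fun _ => norm_nonneg _) (fun n => hle n u) ha
  have hs' : ∀ u, Summable fun n => ‖(starRingEnd ℂ) ((a n : ℂ) * z u ^ n)‖ := by
    intro u
    simpa only [RCLike.norm_conj] using hs u
  have hcont : Continuous z := by fun_prop
  have hprod : Summable fun p : ℕ × ℕ => |a p.1| * |a p.2| :=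
    ha.mul_of_nonneg ha (fun _ => abs_nonneg _) (fun _ => abs_nonneg _)
  have key := intervalIntegral.hasSum_integral_of_dominated_convergence (μ := volume)
    (a := 0) (b := Real.pi)
    (F := fun (p : ℕ × ℕ) (u : ℝ) =>
      ((a p.1 : ℂ) * z u ^ p.1) * (starRingEnd ℂ) ((a p.2 : ℂ) * z u ^ p.2))
    (f := fun u => ((‖∑' n, (a n : ℂ) * z u ^ n‖ ^ 2 : ℝ) : ℂ))
    (fun p _ => |a p.1| * |a p.2|)
    (fun p => Continuous.aestronglyMeasurable (by fun_prop))
    (fun p => Filter.Eventually.of_forall fun u _ => by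
      rw [norm_mul, RCLike.norm_conj]
      exact mul_le_mul (hle _ _) (hle _ _) (norm_nonneg _) (abs_nonneg _))
    (Filter.Eventually.of_forall fun u _ => hprod)
    (by simp)
    (Filter.Eventually.of_forall fun u _ => by
      have hsum := (summable_mul_of_summable_norm (hs u) (hs' u)).hasSum
      rwa [← tsum_mul_tsum_of_summable_norm (hs u) (hs' u), ← Complex.conj_tsum,
        Complex.mul_conj, Complex.normSq_eq_norm_sq] at hsum)
  have hterm : ∀ p : ℕ × ℕ, ∫ u in (0 : ℝ)..Real.pi,
      ((a p.1 : ℂ) * z u ^ p.1) * (starRingEnd ℂ) ((a p.2 : ℂ) * z u ^ p.2)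
      = if p.1 = p.2 then ((Real.pi * (a p.1 ^ 2 * (q ^ 2) ^ p.1) : ℝ) : ℂ) else 0 := by
    rintro ⟨m, n⟩
    have hfun : ∀ u : ℝ, ((a m : ℂ) * z u ^ m) * (starRingEnd ℂ) ((a n : ℂ) * z u ^ n)
        = (a m * a n * (-q) ^ m * (-q) ^ n : ℂ)
          * Complex.exp (2 * ((m - n : ℤ) : ℂ) * Complex.I * u) := by
      intro u
      simp only [hz, map_mul, map_pow, map_neg, Complex.conj_ofReal, ← Complex.exp_conj,
        Complex.conj_I, map_ofNat, map_natCast, mul_pow, ← Complex.exp_nat_mul]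
      rw [show 2 * ((m - n : ℤ) : ℂ) * Complex.I * u
        = m * (2 * Complex.I * u) + n * (2 * -Complex.I * u) by push_cast; ring, Complex.exp_add]
      ring
    simp_rw [hfun]
    rw [intervalIntegral.integral_const_mul, integral_exp_two_mul_int_mul_I]
    by_cases hmn : m = n
    · subst hmn
      simp only [sub_self, if_true]
      push_cast
      rw [mul_assoc _ ((-q : ℂ) ^ m) ((-q) ^ m), ← mul_pow, neg_mul_neg]
      ring
    · rw [if_neg (by simpa [sub_eq_zero] using hmn), if_neg hmn, mul_zero]
  simp_rw [hterm] at key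
  have htsum := key.summable.tsum_prod' (fun m => key.summable.prod_factor m)
  rw [key.tsum_eq] at htsum
  simp only [tsum_ite_eq'] at htsum
  rw [intervalIntegral.integral_ofReal, ← Complex.ofReal_tsum, tsum_mul_left] at htsum
  exact Complex.ofReal_injective htsum

lemma norm_one_add_mul_exp {q : ℝ} (h0 : 0 ≤ q) (u : ℝ) :
    ‖1 - -(q : ℂ) * Complex.exp (2 * Complex.I * u)‖
      = (1 + q) * √(1 - 4 * q / (1 + q) ^ 2 * Real.sin u ^ 2) := by
  have hq : 1 + q ≠ 0 := by positivity
  rw [show (1 + q) * √(1 - 4 * q / (1 + q) ^ 2 * Real.sin u ^ 2)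
      = √((1 + q) ^ 2 * (1 - 4 * q / (1 + q) ^ 2 * Real.sin u ^ 2)) by
    rw [Real.sqrt_mul (sq_nonneg _), Real.sqrt_sq (by positivity)],
    Complex.norm_def, Complex.normSq_apply,
    show 2 * Complex.I * (u : ℂ) = ((2 * u : ℝ) : ℂ) * Complex.I by push_cast; ring]
  congr 1
  simp only [Complex.sub_re, Complex.sub_im, Complex.one_re, Complex.one_im, Complex.mul_re,
    Complex.mul_im, Complex.neg_re, Complex.neg_im, Complex.ofReal_re, Complex.ofReal_im,
    Complex.exp_ofReal_mul_I_re, Complex.exp_ofReal_mul_I_im]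
  have hs := Real.sin_sq_add_cos_sq (2 * u)
  have hc : Real.cos (2 * u) = 1 - 2 * Real.sin u ^ 2 := by
    rw [Real.cos_two_mul, Real.cos_sq']
    ring
  field_simp
  linear_combination q ^ 2 * hs + 2 * q * hc


/-- Landen's transformation: for `0 ≤ x ≤ 1`,
`(1 + √x) · ∑_{m} (−1/(2m−1)) (C(2m,m)/4^m)² (2 x^{1/4}/(1+√x))^{2m}
  = ∑_{n} (C(2n,n)/((2n−1) 4^n))² x^n`. -/
theorem landen_transformation (x : ℝ) (hx0 : 0 ≤ x) (hx1 : x ≤ 1) :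
    (1 + Real.sqrt x) *
      ∑' m : ℕ, (-1 / (2 * (m : ℝ) - 1)) * ((Nat.choose (2 * m) m : ℝ) / 4 ^ m) ^ 2 *
        (2 * x ^ ((1 : ℝ) / 4) / (1 + Real.sqrt x)) ^ (2 * m)
    = ∑' n : ℕ, ((Nat.choose (2 * n) n : ℝ) / ((2 * (n : ℝ) - 1) * 4 ^ n)) ^ 2 * x ^ n := by
  have hq0 : 0 ≤ √x := Real.sqrt_nonneg x
  have hq1 : √x ≤ 1 := Real.sqrt_le_one.mpr hx1
  have hroot : (x ^ ((1 : ℝ) / 4)) ^ 2 = √x := by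
    rw [Real.sqrt_eq_rpow, ← Real.rpow_natCast, ← Real.rpow_mul hx0]
    norm_num
  have hsq : √x ^ 2 = x := Real.sq_sqrt hx0
  generalize √x = q at *
  have hy : (2 * x ^ ((1 : ℝ) / 4) / (1 + q)) ^ 2 = 4 * q / (1 + q) ^ 2 := by
    rw [div_pow, mul_pow, hroot]
    norm_num
  have ht0 : 0 ≤ 4 * q / (1 + q) ^ 2 := by positivity
  have ht1 : 4 * q / (1 + q) ^ 2 ≤ 1 := by
    rw [div_le_one (by positivity)]
    nlinarith [sq_nonneg (1 - q)]
  have hparseval := integral_norm_tsum_sq summable_abs_sqrtCoeff hq0 hq1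
  have hz : ∀ u : ℝ, ‖-(q : ℂ) * Complex.exp (2 * Complex.I * u)‖ ≤ 1 := by
    intro u
    rw [show 2 * Complex.I * (u : ℂ) = ((2 * u : ℝ) : ℂ) * Complex.I by push_cast; ring,
      norm_mul, norm_neg, Complex.norm_exp_ofReal_mul_I, mul_one, Complex.norm_real,
      Real.norm_eq_abs, abs_of_nonneg hq0]
    exact hq1
  simp_rw [norm_tsum_sqrtCoeff_mul_pow_sq (hz _), norm_one_add_mul_exp hq0] at hparseval
  rw [intervalIntegral.integral_const_mul, integral_sqrt_one_sub_mul_sin_sq ht0 ht1, hsq,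
    mul_left_comm] at hparseval
  convert mul_left_cancel₀ Real.pi_ne_zero hparseval using 3
  · refine funext fun m => ?_
    rw [pow_mul, hy, sqrtCoeff, ← div_div]
    ring
  · rw [sqrtCoeff, neg_sq]
end

section
/- Let a ≥ b > 0 be real numbers, let e = √(a² − b²)/a be the eccentricity of the ellipse with semi-axes a and b, and let p = ∫₀^{2π} √(a²·sin²t + b²·cos²t) dt be its perimeter (arc length of the parametrization t ↦ (a cos t, b sin t)). Then p = 2πa · ∑_{m=0}^∞ (−1/(2m−1)) · (C(2m,m)/4^m)² · e^{2m} (Maclaurin's formula) and p = π(a+b) · ∑_{n=0}^∞ (C(2n,n)/((2n−1)·4^n))² · ((a−b)/(a+b))^{2n} (Ivory's formula). -/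
open Real intervalIntegral

/-- The Taylor coefficients of `√(1 - x)`. -/
noncomputable def sqrtOneSubCoeff (n : ℕ) : ℝ :=
  -((Nat.choose (2 * n) n : ℝ) / ((2 * (n : ℝ) - 1) * 4 ^ n))

lemma two_mul_natCast_sub_one_ne_zero (n : ℕ) : 2 * (n : ℝ) - 1 ≠ 0 := by
  intro h
  have h' : ((2 * n : ℕ) : ℝ) = (1 : ℕ) := by push_cast; linarith
  have := Nat.cast_injective h'
  omega

lemma natCast_succ_mul_choose (n : ℕ) :
    ((n : ℝ) + 1) * (Nat.choose (2 * (n + 1)) (n + 1) : ℝ) =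
      2 * (2 * n + 1) * (Nat.choose (2 * n) n : ℝ) := by
  have := Nat.succ_mul_centralBinom_succ n
  rw [Nat.centralBinom_eq_two_mul_choose, Nat.centralBinom_eq_two_mul_choose] at this
  exact_mod_cast this

lemma succ_mul_ringChoose_succ (r : ℝ) (n : ℕ) :
    ((n : ℝ) + 1) * Ring.choose r (n + 1) = (r - n) * Ring.choose r n := by
  simp only [Ring.choose_eq_smul, descPochhammer_succ_right, Polynomial.smeval_mul,
    Polynomial.smeval_sub, Polynomial.smeval_X, Polynomial.smeval_natCast, Nat.factorial_succ,
    smul_eq_mul, Nat.cast_mul, Nat.cast_succ]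
  have := Nat.factorial_ne_zero n
  have : (n : ℝ) + 1 ≠ 0 := by positivity
  simp
  field_simp

lemma ringChoose_half (n : ℕ) : Ring.choose (1 / 2 : ℝ) n * (-1) ^ n = sqrtOneSubCoeff n := by
  induction n with
  | zero => simp [sqrtOneSubCoeff]
  | succ n ih =>
    have h0 : (n : ℝ) + 1 ≠ 0 := by positivity
    have h1 := two_mul_natCast_sub_one_ne_zero n
    have h2 := two_mul_natCast_sub_one_ne_zero (n + 1)
    have hr := succ_mul_ringChoose_succ (1 / 2) n
    have hc := natCast_succ_mul_choose n
    apply mul_left_cancel₀ h0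
    calc _ = ((n : ℝ) + 1) * Ring.choose (1 / 2 : ℝ) (n + 1) * (-1) ^ (n + 1) := by ring
      _ = -(1 / 2 - n) * (Ring.choose (1 / 2 : ℝ) n * (-1) ^ n) := by rw [hr]; ring
      _ = _ := by
        rw [ih]
        have h3 : sqrtOneSubCoeff (n + 1) =
            -(((n + 1) * (Nat.choose (2 * (n + 1)) (n + 1) : ℝ)) /
              ((n + 1) * (2 * n + 1) * (4 * 4 ^ n))) := by
          have : 2 * (n : ℝ) + 1 ≠ 0 := by positivity
          unfold sqrtOneSubCoeff
          push_cast
          rw [show 2 * ((n : ℝ) + 1) - 1 = 2 * n + 1 by ring, pow_succ']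
          field_simp
        rw [h3, hc, sqrtOneSubCoeff]
        field_simp
        ring

lemma abs_sqrtOneSubCoeff_le_one (n : ℕ) : |sqrtOneSubCoeff n| ≤ 1 := by
  have hn : 1 ≤ |2 * (n : ℝ) - 1| := by
    rcases n with _ | n
    · simp
    · push_cast
      rw [abs_of_nonneg] <;> linarith [(Nat.cast_nonneg n : (0 : ℝ) ≤ n)]
  have hc : (Nat.choose (2 * n) n : ℝ) ≤ 4 ^ n := by
    exact_mod_cast Nat.centralBinom_eq_two_mul_choose n ▸ Nat.centralBinom_le_four_pow n
  have h4 : (0 : ℝ) < 4 ^ n := by positivity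
  rw [sqrtOneSubCoeff, abs_neg, abs_div, abs_mul, abs_of_pos h4, Nat.abs_cast]
  apply div_le_one_of_le₀ _ (by positivity)
  nlinarith

lemma hasSum_sqrt_one_sub {x : ℝ} (hx : |x| < 1) :
    HasSum (fun n ↦ sqrtOneSubCoeff n * x ^ n) (√(1 - x)) := by
  have h := (Real.one_add_rpow_hasFPowerSeriesOnBall_zero (a := 1 / 2)).hasSum (y := -x)
    (by simpa [enorm_eq_nnnorm, ← NNReal.coe_lt_coe] using hx)
  simp only [binomialSeries_apply, List.ofFn_const, List.prod_replicate, smul_eq_mul, zero_add] at h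
  simp only [← sub_eq_add_neg, ← Real.sqrt_eq_rpow] at h
  convert! h using 2 with n
  rw [← ringChoose_half, neg_pow x, mul_assoc]

lemma hasSum_one_sub_cpow_half {z : ℂ} (hz : ‖z‖ < 1) :
    HasSum (fun n ↦ (sqrtOneSubCoeff n : ℂ) * z ^ n) ((1 - z) ^ (2⁻¹ : ℂ)) := by
  have h := (Complex.one_add_cpow_hasFPowerSeriesOnBall_zero (a := 2⁻¹)).hasSum (y := -z)
    (by simpa [enorm_eq_nnnorm, ← NNReal.coe_lt_coe] using hz)
  simp only [binomialSeries_apply, List.ofFn_const, List.prod_replicate, smul_eq_mul, zero_add] at h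
  simp only [← sub_eq_add_neg] at h
  convert! h using 2 with n
  have hn : Ring.choose (2⁻¹ : ℂ) n = (Ring.choose (1 / 2 : ℝ) n : ℝ) := by
    rw [Complex.ofReal_choose]; simp
  rw [← ringChoose_half, neg_pow z, hn]
  push_cast
  ring

lemma integral_cos_pow_two_mul (m : ℕ) :
    ∫ t in (0 : ℝ)..(2 * π), cos t ^ (2 * m) = 2 * π * ((Nat.choose (2 * m) m : ℝ) / 4 ^ m) := by
  induction m with
  | zero => simp
  | succ m ih =>
    rw [mul_add_one, integral_cos_pow, ih]
    have h := natCast_succ_mul_choose m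
    have h3 : (Nat.choose (2 * (m + 1)) (m + 1) : ℝ) =
        2 * (2 * m + 1) * (Nat.choose (2 * m) m : ℝ) / (m + 1) := by
      rw [← h]; field_simp
    rw [← mul_add_one, h3]
    simp
    field_simp
    ring

lemma integral_exp_two_mul_mul_I (k : ℤ) :
    ∫ t in (0 : ℝ)..(2 * π), Complex.exp (2 * k * Complex.I * t) = if k = 0 then 2 * π else 0 := by
  split_ifs with h
  · simp [h]
  · rw [integral_exp_mul_complex (by simp [h])]
    have : Complex.exp (2 * k * Complex.I * ↑(2 * π)) = 1 := by
      rw [Complex.exp_eq_one_iff]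
      exact ⟨2 * k, by push_cast; ring⟩
    rw [this]; simp

lemma norm_one_sub_mul_exp_sq (r t : ℝ) :
    ‖1 - r * Complex.exp (2 * Complex.I * t)‖ ^ 2 =
      (1 + r) ^ 2 * sin t ^ 2 + (1 - r) ^ 2 * cos t ^ 2 := by
  have h : 1 - r * Complex.exp (2 * Complex.I * t) =
      (1 - r * cos (2 * t) : ℝ) + (- r * sin (2 * t) : ℝ) * Complex.I := by
    rw [show 2 * Complex.I * t = ((2 * t : ℝ) : ℂ) * Complex.I by push_cast; ring, Complex.exp_mul_I]
    push_cast
    ring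
  rw [h, Complex.norm_add_mul_I, Real.sq_sqrt (by positivity), cos_two_mul, sin_two_mul]
  linear_combination (4 * r ^ 2 * cos t ^ 2 - (1 + r) ^ 2) * sin_sq t

lemma hasSum_intervalIntegral_of_norm_le {ι E : Type*} [Countable ι] [NormedAddCommGroup E]
    [NormedSpace ℝ E] {f : ι → ℝ → E} {F : ℝ → E} {u : ι → ℝ} {a b : ℝ}
    (hf : ∀ i, Continuous (f i)) (hfu : ∀ i t, ‖f i t‖ ≤ u i) (hu : Summable u)
    (hF : ∀ t, HasSum (f · t) (F t)) :
    HasSum (fun i ↦ ∫ t in a..b, f i t) (∫ t in a..b, F t) :=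
  intervalIntegral.hasSum_integral_of_dominated_convergence (fun i _ ↦ u i)
    (fun i ↦ (hf i).aestronglyMeasurable) (fun i ↦ .of_forall fun t _ ↦ hfu i t)
    (.of_forall fun _ _ ↦ hu) (by simp) (.of_forall fun t _ ↦ hF t)

/-- The complete elliptic integral of the second kind as a power series in the modulus. -/
lemma hasSum_integral_sqrt_one_sub_sq_mul_cos_sq {k : ℝ} (hk : |k| < 1) :
    HasSum (fun m ↦ sqrtOneSubCoeff m * k ^ (2 * m) *
        (2 * π * ((Nat.choose (2 * m) m : ℝ) / 4 ^ m)))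
      (∫ t in (0 : ℝ)..(2 * π), √(1 - k ^ 2 * cos t ^ 2)) := by
  have hk2 : k ^ 2 < 1 := (sq_lt_one_iff_abs_lt_one k).2 hk
  have h := hasSum_intervalIntegral_of_norm_le (a := 0) (b := 2 * π)
    (f := fun m t ↦ sqrtOneSubCoeff m * k ^ (2 * m) * cos t ^ (2 * m))
    (F := fun t ↦ √(1 - k ^ 2 * cos t ^ 2)) (u := fun m ↦ (k ^ 2) ^ m)
    (fun m ↦ by fun_prop) (fun m t ↦ ?_) (summable_geometric_of_lt_one (sq_nonneg k) hk2)
    (fun t ↦ ?_)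
  · simpa only [integral_const_mul, integral_cos_pow_two_mul] using h
  · have hc : (cos t ^ 2) ^ m ≤ 1 := pow_le_one₀ (sq_nonneg _) (cos_sq_le_one t)
    rw [pow_mul, pow_mul, norm_mul, norm_mul, Real.norm_eq_abs, Real.norm_of_nonneg (by positivity),
      Real.norm_of_nonneg (by positivity)]
    calc _ ≤ 1 * (k ^ 2) ^ m * 1 := by gcongr; exact abs_sqrtOneSubCoeff_le_one m
      _ = _ := by ring
  · have hx : |k ^ 2 * cos t ^ 2| < 1 := by
      rw [abs_of_nonneg (by positivity)]
      nlinarith [cos_sq_le_one t, sq_nonneg k]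
    simpa only [mul_pow, ← pow_mul, mul_assoc] using hasSum_sqrt_one_sub hx

/-- Parseval's identity for an absolutely convergent series `∑ dₙ e^{2int}` with real `dₙ`. -/
lemma hasSum_integral_norm_sq {d : ℕ → ℝ} (hd : Summable (fun n ↦ |d n|)) {F : ℝ → ℂ}
    (hF : ∀ t : ℝ, HasSum (fun n : ℕ ↦ d n * Complex.exp (2 * Complex.I * t) ^ n) (F t)) :
    HasSum (fun n ↦ 2 * π * d n ^ 2) (∫ t in (0 : ℝ)..(2 * π), ‖F t‖ ^ 2) := by
  have hconj (t : ℝ) :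
      (starRingEnd ℂ) (Complex.exp (2 * Complex.I * t)) = Complex.exp (-(2 * Complex.I * t)) := by
    simp [← Complex.exp_conj, map_ofNat (starRingEnd ℂ) 2]
  have hexp (m n : ℕ) (t : ℝ) : Complex.exp (2 * Complex.I * t) ^ m *
      Complex.exp (-(2 * Complex.I * t)) ^ n = Complex.exp (2 * (m - n : ℤ) * Complex.I * t) := by
    rw [← Complex.exp_nat_mul, ← Complex.exp_nat_mul, ← Complex.exp_add]
    push_cast
    ring_nf
  have hbound : Summable (fun x : ℕ × ℕ ↦ |d x.1| * |d x.2|) :=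
    hd.mul_of_nonneg hd (fun _ ↦ abs_nonneg _) (fun _ ↦ abs_nonneg _)
  have hle (x : ℕ × ℕ) (t : ℝ) :
      ‖(d x.1 * d x.2 : ℝ) * Complex.exp (2 * (x.1 - x.2 : ℤ) * Complex.I * t)‖ ≤
        |d x.1| * |d x.2| := by
    rw [show 2 * ((x.1 - x.2 : ℤ) : ℂ) * Complex.I * t =
      ((2 * (x.1 - x.2 : ℤ) * t : ℝ) : ℂ) * Complex.I by push_cast; ring,
      norm_mul, Complex.norm_exp_ofReal_mul_I, Complex.norm_real, mul_one, norm_mul]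
    rfl
  have hsum (t : ℝ) : HasSum (fun x : ℕ × ℕ ↦
      (d x.1 * d x.2 : ℝ) * Complex.exp (2 * (x.1 - x.2 : ℤ) * Complex.I * t))
      ((‖F t‖ ^ 2 : ℝ) : ℂ) := by
    have hterm (x : ℕ × ℕ) : d x.1 * Complex.exp (2 * Complex.I * t) ^ x.1 *
        (starRingEnd ℂ) (d x.2 * Complex.exp (2 * Complex.I * t) ^ x.2) =
        (d x.1 * d x.2 : ℝ) * Complex.exp (2 * (x.1 - x.2 : ℤ) * Complex.I * t) := by
      rw [map_mul, map_pow, hconj, Complex.conj_ofReal, ← hexp]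
      push_cast
      ring
    have h := (hF t).mul ((hF t).map (starRingEnd ℂ) Complex.continuous_conj)
    simp only [Function.comp_apply, hterm] at h
    rw [← Complex.normSq_eq_norm_sq, ← Complex.mul_conj]
    exact h (.of_norm_bounded hbound (hle · t))
  have h := hasSum_intervalIntegral_of_norm_le (a := 0) (b := 2 * π) (fun x ↦ by fun_prop) hle
    hbound hsum
  simp only [intervalIntegral.integral_const_mul, integral_exp_two_mul_mul_I,
    intervalIntegral.integral_ofReal] at h
  rw [← Function.Injective.hasSum_iff (g := fun n : ℕ ↦ (n, n))
    (fun _ _ h ↦ (Prod.ext_iff.1 h).1)] at h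
  · rw [← Complex.hasSum_ofReal]
    convert! h using 2 with n
    simp
    ring
  · rintro ⟨m, n⟩ hmn
    have : (m : ℤ) - n ≠ 0 := fun h ↦ hmn ⟨m, by simp; omega⟩
    simp [this]

lemma hasSum_integral_norm_one_sub_mul_exp {r : ℝ} (hr : |r| < 1) :
    HasSum (fun n ↦ 2 * π * (sqrtOneSubCoeff n * r ^ n) ^ 2)
      (∫ t in (0 : ℝ)..(2 * π), ‖1 - r * Complex.exp (2 * Complex.I * t)‖) := by
  have hnorm (t : ℝ) : ‖(r : ℂ) * Complex.exp (2 * Complex.I * t)‖ = |r| := by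
    rw [norm_mul, show 2 * Complex.I * t = ((2 * t : ℝ) : ℂ) * Complex.I by push_cast; ring,
      Complex.norm_exp_ofReal_mul_I, mul_one, Complex.norm_real, Real.norm_eq_abs]
  have hsq (z : ℂ) : ‖z ^ (2⁻¹ : ℂ)‖ ^ 2 = ‖z‖ := by
    rw [← norm_pow]
    exact congrArg _ (Complex.cpow_nat_inv_pow z two_ne_zero)
  have hd : Summable (fun n ↦ |sqrtOneSubCoeff n * r ^ n|) := by
    refine .of_nonneg_of_le (fun _ ↦ abs_nonneg _) (fun n ↦ ?_)
      (summable_geometric_of_lt_one (abs_nonneg r) hr)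
    rw [abs_mul, abs_pow]
    exact mul_le_of_le_one_left (by positivity) (abs_sqrtOneSubCoeff_le_one n)
  simp_rw [← hsq (1 - _)]
  refine hasSum_integral_norm_sq hd fun t ↦ ?_
  simpa only [mul_pow, mul_assoc, Complex.ofReal_mul, Complex.ofReal_pow] using
    hasSum_one_sub_cpow_half ((hnorm t).trans_lt hr)

/-- Maclaurin's and Ivory's formulas for the perimeter of an ellipse with
semi-axes `a ≥ b > 0` and eccentricity `e = √(a² − b²)/a`. -/
theorem ellipse_perimeter_formulas (a b : ℝ) (hb : 0 < b) (hba : b ≤ a)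
    (e : ℝ) (he : e = Real.sqrt (a ^ 2 - b ^ 2) / a)
    (p : ℝ)
    (hp : p = ∫ t in (0 : ℝ)..(2 * Real.pi),
      Real.sqrt (a ^ 2 * Real.sin t ^ 2 + b ^ 2 * Real.cos t ^ 2)) :
    p = 2 * Real.pi * a *
        ∑' m : ℕ, (-1 / (2 * (m : ℝ) - 1)) * ((Nat.choose (2 * m) m : ℝ) / 4 ^ m) ^ 2 *
          e ^ (2 * m)
    ∧ p = Real.pi * (a + b) *
        ∑' n : ℕ, ((Nat.choose (2 * n) n : ℝ) / ((2 * (n : ℝ) - 1) * 4 ^ n)) ^ 2 *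
          ((a - b) / (a + b)) ^ (2 * n) := by
  have ha : 0 < a := hb.trans_le hba
  have hab : 0 < a + b := by positivity
  constructor
  · have he2 : e ^ 2 = (a ^ 2 - b ^ 2) / a ^ 2 := by
      rw [he, div_pow, Real.sq_sqrt]
      nlinarith
    have he1 : |e| < 1 := by
      rw [← sq_lt_one_iff_abs_lt_one, he2, div_lt_one (by positivity)]
      linarith [pow_pos hb 2]
    have hint (t : ℝ) : √(a ^ 2 * sin t ^ 2 + b ^ 2 * cos t ^ 2) =
        a * √(1 - e ^ 2 * cos t ^ 2) := by
      rw [← Real.sqrt_sq ha.le, ← Real.sqrt_mul (sq_nonneg a), Real.sqrt_sq ha.le, he2, sin_sq]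
      congr 1
      field_simp
      ring
    simp_rw [hp, hint, intervalIntegral.integral_const_mul,
      ← (hasSum_integral_sqrt_one_sub_sq_mul_cos_sq he1).tsum_eq, ← tsum_mul_left]
    congr 1 with m
    have := two_mul_natCast_sub_one_ne_zero m
    rw [sqrtOneSubCoeff]
    field_simp
  · have hr : |(a - b) / (a + b)| < 1 := by
      rw [abs_lt, lt_div_iff₀ hab, div_lt_one hab]
      constructor <;> linarith
    have hint (t : ℝ) : √(a ^ 2 * sin t ^ 2 + b ^ 2 * cos t ^ 2) =
        (a + b) / 2 * ‖1 - ((a - b) / (a + b) : ℝ) * Complex.exp (2 * Complex.I * t)‖ := by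
      rw [Real.sqrt_eq_iff_eq_sq (by positivity) (by positivity), mul_pow, norm_one_sub_mul_exp_sq]
      field_simp
      ring
    simp_rw [hp, hint, intervalIntegral.integral_const_mul,
      ← (hasSum_integral_norm_one_sub_mul_exp hr).tsum_eq, ← tsum_mul_left]
    congr 1 with n
    rw [sqrtOneSubCoeff]
    ring
end
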